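/- Let p and q be distinct odd primes, and let g_p^# and g_q^# ∈ ℤ[X] be trace polynomials of g_p and g_q respectively. Then Res(g_p^#, g_q^#) equals the Legendre symbol (q/p). -/

import Mathlib

open Polynomial


/-- The companion matrix of a polynomial `f` (with respect to its `natDegree`):
1's on the subdiagonal, last column `(-a_0, …, -a_{m-1})ᵀ`. -/
noncomputable def companion {R : Type*} [CommRing R] (f : R[X]) :
    Matrix (Fin f.natDegree) (Fin f.natDegree) R := fun i j =>
  (if (i : ℕ) = (j : ℕ) + 1 then 1 else 0) +
  (if (j : ℕ) + 1 = f.natDegree then -f.coeff i else 0)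

/-- The resultant `Res(f,g) = det (g (C_f))`. -/
noncomputable def Res {R : Type*} [CommRing R] (f g : R[X]) : R :=
  (Polynomial.aeval (companion f) g).det


/-- `h` is a trace polynomial of `g` (of even degree `2m`):
`deg h ≤ m` and `g(X) = X^m · h(X + 1/X)`, encoded polynomially. -/
def IsTracePoly {R : Type*} [CommRing R] (g h : R[X]) (m : ℕ) : Prop :=
  h.natDegree ≤ m ∧
    g = ∑ k ∈ Finset.range (m + 1), Polynomial.C (h.coeff k) * X ^ (m - k) * (X ^ 2 + 1) ^ k


/-- `g_n = 1 + X + ⋯ + X^(n-1) = (X^n - 1)/(X - 1)`. -/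
noncomputable def gpoly (n : ℕ) : ℤ[X] := ∑ k ∈ Finset.range n, X ^ k

/-- A monic polynomial annihilates its companion matrix. -/
theorem aeval_companion_self {R : Type*} [CommRing R] {f : R[X]} (hf : f.Monic) :
    aeval (companion f) f = 0 := by
  nontriviality R
  let pb := AdjoinRoot.powerBasis' hf
  have hdim : pb.dim = f.natDegree := rfl
  have hroot : pb.gen = AdjoinRoot.root f := rfl
  have hgen : pb.minpolyGen = f := by
    have hdvd : f ∣ pb.minpolyGen := by
      rw [← AdjoinRoot.mk_eq_zero, ← AdjoinRoot.aeval_eq, ← hroot]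
      exact pb.aeval_minpolyGen
    refine eq_of_monic_of_dvd_of_natDegree_le hf pb.minpolyGen_monic hdvd ?_
    rw [pb.natDegree_minpolyGen, hdim]
  have hmat : Algebra.leftMulMatrix pb.basis pb.gen = companion f := by
    rw [pb.leftMulMatrix, hgen]
    ext i j
    have hi : (i : ℕ) < f.natDegree := i.isLt
    change (if (j : ℕ) + 1 = f.natDegree then -f.coeff i else if (i : ℕ) = j + 1 then 1 else 0) =
      (if (i : ℕ) = (j : ℕ) + 1 then 1 else 0) +
        (if (j : ℕ) + 1 = f.natDegree then -f.coeff i else 0)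
    split_ifs with h₁ h₂ <;> first | omega | simp
  have hroot₀ : aeval pb.gen f = 0 := by rw [hroot, AdjoinRoot.aeval_eq, AdjoinRoot.mk_self]
  have hzero := Polynomial.aeval_algHom_apply (Algebra.leftMulMatrix pb.basis) pb.gen f
  rw [hroot₀, map_zero, hmat] at hzero
  exact hzero

theorem Matrix.det_scalar_add_of_isNilpotent {R n : Type*} [CommRing R] [IsDomain R]
    [Fintype n] [DecidableEq n] {N : Matrix n n R} (hN : IsNilpotent N) (c : R) :
    (Matrix.scalar n c + N).det = c ^ Fintype.card n := by
  have h := (Matrix.isNilpotent_charpoly_sub_pow_of_isNilpotent hN.neg).eq_zero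
  rw [sub_eq_zero] at h
  rw [← sub_neg_eq_add, ← Matrix.eval_charpoly, h]
  simp

namespace IsTracePoly

variable {R : Type*} [CommRing R] {g h : R[X]} {m : ℕ}

theorem coeff_eq (hh : IsTracePoly g h m) : h.coeff m = g.coeff 0 := by
  rw [hh.2, coeff_zero_eq_eval_zero, eval_finsetSum, Finset.sum_eq_single m]
  · simp
  · intro k hk hkm
    have : m - k ≠ 0 := by grind
    simp [this]
  · simp

theorem monic (hh : IsTracePoly g h m) (hg : g.coeff 0 = 1) : h.Monic :=
  monic_of_natDegree_le_of_coeff_eq_one m hh.1 (hh.coeff_eq.trans hg)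

theorem natDegree_eq [Nontrivial R] (hh : IsTracePoly g h m) (hg : g.coeff 0 = 1) :
    h.natDegree = m :=
  natDegree_eq_of_le_of_coeff_ne_zero hh.1 (by rw [hh.coeff_eq, hg]; exact one_ne_zero)

/-- The identity `g(x) = x ^ m * h(x + 1/x)`, with `y` in the role of `x + 1/x`. -/
theorem eval₂_eq {S : Type*} [CommRing S] (hh : IsTracePoly g h m) (φ : R →+* S) {x y : S}
    (hxy : x ^ 2 + 1 = x * y) : g.eval₂ φ x = x ^ m * h.eval₂ φ y := by
  rw [hh.2, eval₂_finsetSum, eval₂_eq_sum_range' φ (Nat.lt_succ_of_le hh.1), Finset.mul_sum]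
  refine Finset.sum_congr rfl fun k hk => ?_
  have hkm : m - k + k = m := by grind
  simp only [eval₂_mul, eval₂_C, eval₂_pow, eval₂_X, eval₂_add, eval₂_one, hxy, mul_pow]
  rw [← hkm, pow_add, hkm]
  ring

theorem eval_two (hh : IsTracePoly g h m) : h.eval 2 = g.eval 1 := by
  simpa [eval₂_id] using (hh.eval₂_eq (RingHom.id R) (x := 1) (y := 2) (by norm_num)).symm

end IsTracePoly

theorem exists_sq_add_one_eq_mul {K : Type*} [Field K] [IsAlgClosed K] (y : K) :
    ∃ x : K, x ^ 2 + 1 = x * y := by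
  have hdeg : (X ^ 2 - C y * X + 1 : K[X]).degree = 2 := by compute_degree!
  obtain ⟨x, hx⟩ := IsAlgClosed.exists_root (X ^ 2 - C y * X + 1 : K[X]) (by simp [hdeg])
  refine ⟨x, ?_⟩
  simp only [IsRoot.def, eval_add, eval_sub, eval_pow, eval_X, eval_mul, eval_C, eval_one] at hx
  linear_combination hx

theorem gpoly_coeff_zero {n : ℕ} (hn : n ≠ 0) : (gpoly n).coeff 0 = 1 := by
  simp [gpoly, coeff_X_pow, hn, Nat.pos_iff_ne_zero]

theorem gpoly_eval_one (n : ℕ) : (gpoly n).eval 1 = n := by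
  simp [gpoly, eval_finsetSum]

theorem gpoly_eval₂ {S : Type*} [CommRing S] (φ : ℤ →+* S) (n : ℕ) (x : S) :
    (gpoly n).eval₂ φ x = ∑ k ∈ Finset.range n, x ^ k := by
  simp [gpoly, eval₂_finsetSum]

theorem pow_eq_one_of_geom_sum_eq_zero {S : Type*} [CommRing S] {x : S} {n : ℕ}
    (h : ∑ k ∈ Finset.range n, x ^ k = 0) : x ^ n = 1 := by
  have := geom_sum_mul x n
  rw [h, zero_mul] at this
  exact sub_eq_zero.mp this.symm

/-- The trace polynomials of `g_a` and `g_b` generate the unit ideal when `a` and `b` are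
coprime. -/
theorem isCoprime_tracePoly {a b m n : ℕ} {f g : ℤ[X]} (hab : a.Coprime b)
    (hf : IsTracePoly (gpoly a) f m) (hg : IsTracePoly (gpoly b) g n) : IsCoprime f g := by
  rw [← Ideal.isCoprime_span_singleton_iff, Ideal.isCoprime_iff_sup_eq]
  by_contra hne
  obtain ⟨M, hM, hle⟩ := Ideal.exists_le_maximal _ hne
  let _ := Ideal.Quotient.field M
  let φ : ℤ[X] →+* AlgebraicClosure (ℤ[X] ⧸ M) := (algebraMap _ _).comp (Ideal.Quotient.mk M)
  have hφ (u : ℤ[X]) (hu : u ∈ M) : u.eval₂ (Int.castRingHom _) (φ X) = 0 := by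
    rw [eval₂_intCastRingHom_X]
    simp [φ, Ideal.Quotient.eq_zero_iff_mem.mpr hu]
  obtain ⟨x, hx⟩ := exists_sq_add_one_eq_mul (φ X)
  have hfx := hf.eval₂_eq (Int.castRingHom _) hx
  have hgx := hg.eval₂_eq (Int.castRingHom _) hx
  rw [hφ f (hle (Ideal.mem_sup_left (Ideal.mem_span_singleton_self f))), mul_zero,
    gpoly_eval₂] at hfx
  rw [hφ g (hle (Ideal.mem_sup_right (Ideal.mem_span_singleton_self g))), mul_zero,
    gpoly_eval₂] at hgx
  have hx₁ : x = 1 := by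
    rw [← pow_one x, ← hab.gcd_eq_one, pow_gcd_eq_one]
    exact ⟨pow_eq_one_of_geom_sum_eq_zero hfx, pow_eq_one_of_geom_sum_eq_zero hgx⟩
  simp only [hx₁, one_pow, Finset.sum_const, Finset.card_range, nsmul_eq_mul, mul_one] at hfx hgx
  obtain ⟨u, v, huv⟩ := Nat.isCoprime_iff_coprime.mpr hab
  have := congrArg (Int.cast : ℤ → AlgebraicClosure (ℤ[X] ⧸ M)) huv
  push_cast at this
  simp [hfx, hgx] at this

/-- Modulo `p`, a trace polynomial of `g_p` has no root other than `2`. -/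
theorem X_sub_two_mem_radical {p m : ℕ} [Fact p.Prime] {f : ℤ[X]}
    (hf : IsTracePoly (gpoly p) f m) :
    (X - 2 : ℤ[X]) ∈ (Ideal.span {f, (p : ℤ[X])}).radical := by
  rw [Ideal.radical_eq_sInf, Ideal.mem_sInf]
  rintro P ⟨hle, hP⟩
  let K := AlgebraicClosure (FractionRing (ℤ[X] ⧸ P))
  let φ : ℤ[X] →+* K := ((algebraMap (FractionRing (ℤ[X] ⧸ P)) K).comp (algebraMap _ _)).comp
    (Ideal.Quotient.mk P)
  have hφ (u : ℤ[X]) : φ u = 0 ↔ u ∈ P := by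
    rw [RingHom.comp_apply, RingHom.comp_apply, map_eq_zero,
      map_eq_zero_iff _ (IsFractionRing.injective _ _), Ideal.Quotient.eq_zero_iff_mem]
  have hfP : φ f = 0 := (hφ f).mpr (hle (Ideal.subset_span (by simp)))
  have hpP : φ p = 0 := (hφ p).mpr (hle (Ideal.subset_span (by simp)))
  have : CharP K p := by
    rw [map_natCast] at hpP
    exact (CharP.charP_iff_prime_eq_zero Fact.out).mpr hpP
  obtain ⟨x, hx⟩ := exists_sq_add_one_eq_mul (φ X)
  have hfx := hf.eval₂_eq (Int.castRingHom _) hx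
  rw [eval₂_intCastRingHom_X, hfP, mul_zero, gpoly_eval₂] at hfx
  have hx₁ : x = 1 := by
    rw [← sub_eq_zero]
    refine eq_zero_of_pow_eq_zero (n := p) ?_
    rw [sub_pow_char, one_pow, pow_eq_one_of_geom_sum_eq_zero hfx, sub_self]
  rw [← hφ, map_sub, map_ofNat]
  rw [hx₁] at hx
  linear_combination -hx

theorem isUnit_Res {R : Type*} [CommRing R] {f g : R[X]} (hf : f.Monic) (h : IsCoprime f g) :
    IsUnit (Res f g) := by
  obtain ⟨u, v, huv⟩ := h
  have := congrArg (aeval (companion f)) huv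
  rw [map_add, map_mul, map_mul, aeval_companion_self hf, mul_zero, zero_add, map_one] at this
  exact (Matrix.isUnit_iff_isUnit_det _).mp (.of_mul_eq_one_right _ this)

/-- Modulo `p`, the resultant of a trace polynomial of `g_p` with `g` is `g(2) ^ m`. -/
theorem Res_tracePoly_cast {p m : ℕ} [Fact p.Prime] {f : ℤ[X]}
    (hf : IsTracePoly (gpoly p) f m) (g : ℤ[X]) :
    ((Res f g : ℤ) : ZMod p) = ((g.eval 2 : ℤ) : ZMod p) ^ m := by
  have hp₀ : (gpoly p).coeff 0 = 1 := gpoly_coeff_zero (Fact.out : p.Prime).ne_zero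
  obtain ⟨n, hn⟩ := X_sub_two_mem_radical hf
  obtain ⟨a, b, hab⟩ := Ideal.mem_span_pair.mp hn
  let ψ : ℤ[X] →+* Matrix (Fin f.natDegree) (Fin f.natDegree) (ZMod p) :=
    (Int.castRingHom (ZMod p)).mapMatrix.comp (aeval (companion f)).toRingHom
  have hψf : ψ f = 0 := by
    have : aeval (companion f) f = 0 := aeval_companion_self (hf.monic hp₀)
    simp [ψ, this]
  have hψp : ψ p = 0 := by
    rw [map_natCast, ← Matrix.diagonal_natCast]
    simp
  have hnil : IsNilpotent (ψ (X - 2)) := ⟨n, by rw [← map_pow, ← hab]; simp [hψf, hψp]⟩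
  obtain ⟨k, hk⟩ := X_sub_C_dvd_sub_C_eval (a := (2 : ℤ)) (p := g)
  have hg : ψ g = Matrix.scalar _ ((g.eval 2 : ℤ) : ZMod p) + ψ ((X - 2) * k) := by
    have hC : ψ (C (g.eval 2)) = Matrix.scalar _ ((g.eval 2 : ℤ) : ZMod p) := by
      rw [show C (g.eval 2) = ((g.eval 2 : ℤ) : ℤ[X]) from eq_intCast C _, map_intCast,
        map_intCast]
    have hg' : g = C (g.eval 2) + (X - 2) * k := by
      rw [← C_ofNat, ← hk]
      ring
    rw [← hC, ← map_add, ← hg']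
  have hnil' : IsNilpotent (ψ ((X - 2) * k)) := by
    rw [map_mul]
    exact ((Commute.all (X - 2) k).map ψ).isNilpotent_mul_right hnil
  have hdet : ((Res f g : ℤ) : ZMod p) = (ψ g).det := by
    rw [Res, ← eq_intCast (Int.castRingHom (ZMod p)), RingHom.map_det]
    rfl
  rw [hdet, hg, Matrix.det_scalar_add_of_isNilpotent hnil', Fintype.card_fin,
    hf.natDegree_eq hp₀]

/-- If `p, q` are distinct odd primes with trace polynomials `g_p♯, g_q♯` of
`g_p, g_q`, then `Res(g_p♯, g_q♯)` equals the Legendre symbol `(q/p)`. -/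
theorem rec_eq_legendre (p q : ℕ) [Fact p.Prime] [Fact q.Prime]
    (hp : p ≠ 2) (hq : q ≠ 2) (hpq : p ≠ q) (gps gqs : ℤ[X])
    (hgps : IsTracePoly (gpoly p) gps ((p - 1) / 2))
    (hgqs : IsTracePoly (gpoly q) gqs ((q - 1) / 2)) :
    Res gps gqs = legendreSym p (q : ℤ) := by
  have hpp : p.Prime := Fact.out
  have hqp : q.Prime := Fact.out
  have hunit : IsUnit (Res gps gqs) :=
    isUnit_Res (hgps.monic (gpoly_coeff_zero hpp.ne_zero))
      (isCoprime_tracePoly ((Nat.coprime_primes hpp hqp).mpr hpq) hgps hgqs)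
  have hq₀ : ((q : ℤ) : ZMod p) ≠ 0 := by
    rw [Int.cast_natCast, Ne, ZMod.natCast_eq_zero_iff]
    exact fun h => hpq ((Nat.prime_dvd_prime_iff_eq hpp hqp).mp h)
  have hhalf : (p - 1) / 2 = p / 2 := by
    have := hpp.odd_of_ne_two hp
    grind
  have hcast : ((Res gps gqs : ℤ) : ZMod p) = (legendreSym p (q : ℤ) : ZMod p) := by
    rw [Res_tracePoly_cast hgps, hgqs.eval_two, gpoly_eval_one, legendreSym.eq_pow, hhalf]
  have : Fact (2 < p) := ⟨hpp.two_le.lt_of_ne' hp⟩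
  have hne : (-1 : ZMod p) ≠ 1 := ZMod.neg_one_ne_one
  rcases Int.isUnit_iff.mp hunit with h | h <;>
    rcases legendreSym.eq_one_or_neg_one p hq₀ with h' | h' <;>
    rw [h, h'] at hcast ⊢ <;> push_cast at hcast
  · exact absurd hcast.symm hne
  · exact absurd hcast hne
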